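/- Let b > 0 and let L : ℝ × ℝ → ℝ be a smooth function such that L(0,z) = z²/2 for all z and z ↦ L(ε,z) is even for each ε. Define f(z) = (∂_ε ∂_z L)(0,z)/z for z ≠ 0, and suppose there is a constant k < 0 such that for every z ∈ (0,b]: f''(z) < k and (z²·f'''(z) − z·f''(z) + 2·f'(z))/z < k. Then there exists ε₀ > 0 such that for every ε ∈ (0, ε₀): the function z ↦ ∂_z L(ε,z) is strictly increasing on [0,b]; and, denoting by h_ε its inverse on [0, ∂_z L(ε,b)] and setting A_ε(z) = 1/h_ε'(z), B_ε(z) = z/h_ε(z), α_ε(z) = (z²·A_ε''(z) + 6(A_ε(z) − B_ε(z)) − 4z(A_ε'(z) − B_ε'(z)))/z², β_ε(z) = (z·A_ε'(z) − 2(A_ε(z) − B_ε(z)))/z², γ_ε(z) = B_ε''(z), δ_ε(z) = B_ε'(z)/z, one has β_ε(z) < 0, γ_ε(z) < 0, δ_ε(z) < 0, and α_ε(z) + δ_ε(z) < 2√(β_ε(z)·γ_ε(z)) for every z ∈ (0, ∂_z L(ε,b)]. -/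

import Mathlib

/-- `α(z)` built from `A, B` using one-sided (within `S`) derivatives. -/
noncomputable def mtwAlphaW (S : Set ℝ) (A B : ℝ → ℝ) (z : ℝ) : ℝ :=
  (z ^ 2 * derivWithin (fun y => derivWithin A S y) S z + 6 * (A z - B z) -
    4 * z * (derivWithin A S z - derivWithin B S z)) / z ^ 2

/-- `β(z)` built from `A, B` using derivatives within `S`. -/
noncomputable def mtwBetaW (S : Set ℝ) (A B : ℝ → ℝ) (z : ℝ) : ℝ :=
  (z * derivWithin A S z - 2 * (A z - B z)) / z ^ 2

/-- `γ(z) = B''(z)` using derivatives within `S`. -/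
noncomputable def mtwGammaW (S : Set ℝ) (B : ℝ → ℝ) (z : ℝ) : ℝ :=
  derivWithin (fun y => derivWithin B S y) S z

/-- `δ(z) = B'(z)/z` using the derivative within `S`. -/
noncomputable def mtwDeltaW (S : Set ℝ) (B : ℝ → ℝ) (z : ℝ) : ℝ :=
  derivWithin B S z / z


section Aux
open Set Filter Topology
theorem aux_hasFDerivAt_param {F : Type} [NormedAddCommGroup F] [NormedSpace ℝ F] [CompleteSpace F]
    (u : (ℝ × ℝ) × ℝ → F) (hu : ContDiff ℝ 1 u) (x₀ : ℝ × ℝ) :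
    HasFDerivAt (fun x => ∫ t in (0:ℝ)..1, u (x, t))
      (∫ t in (0:ℝ)..1, (fderiv ℝ u (x₀, t)).comp (ContinuousLinearMap.inl ℝ (ℝ × ℝ) ℝ)) x₀ := by
  have hc : Continuous fun p : (ℝ × ℝ) × ℝ =>
      (fderiv ℝ u p).comp (ContinuousLinearMap.inl ℝ (ℝ × ℝ) ℝ) :=
    (hu.continuous_fderiv one_ne_zero).clm_comp continuous_const
  obtain ⟨C, hC⟩ := ((isCompact_closedBall x₀ 1).prod (isCompact_Icc (a := (0:ℝ)) (b := 1))
    ).exists_bound_of_continuousOn hc.continuousOn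
  refine intervalIntegral.hasFDerivAt_integral_of_dominated_of_fderiv_le
    (F := fun x t => u (x, t))
    (F' := fun x t => (fderiv ℝ u (x, t)).comp (ContinuousLinearMap.inl ℝ (ℝ × ℝ) ℝ))
    (s := Metric.ball x₀ 1) (bound := fun _ => C)
    (Metric.ball_mem_nhds _ one_pos) ?_ ?_ ?_ ?_ ?_ ?_
  · refine Eventually.of_forall fun x => ?_
    exact (hu.continuous.comp (by fun_prop : Continuous fun t : ℝ => (x, t))).aestronglyMeasurable
  · exact (hu.continuous.comp (by fun_prop : Continuous fun t : ℝ => (x₀, t))).intervalIntegrable _ _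
  · exact (hc.comp (by fun_prop : Continuous fun t : ℝ => (x₀, t))).aestronglyMeasurable
  · refine Eventually.of_forall fun t ht x hx => hC (x, t) ⟨Metric.ball_subset_closedBall hx, ?_⟩
    rw [uIoc_of_le zero_le_one] at ht
    exact ⟨ht.1.le, ht.2⟩
  · exact intervalIntegrable_const
  · refine Eventually.of_forall fun t _ x _ => ?_
    have h1 : HasFDerivAt u (fderiv ℝ u (x, t)) (x, t) :=
      (hu.differentiable one_ne_zero (x, t)).hasFDerivAt
    exact h1.comp x (hasFDerivAt_prodMk_left x t)

theorem aux_contDiff_param_nat (n : ℕ) : ∀ {F : Type} [NormedAddCommGroup F] [NormedSpace ℝ F]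
    [CompleteSpace F] (u : (ℝ × ℝ) × ℝ → F) (_ : ContDiff ℝ (⊤ : ℕ∞) u),
    ContDiff ℝ n (fun x => ∫ t in (0:ℝ)..1, u (x, t)) := by
  induction n with
  | zero =>
    intro F _ _ _ u hu
    rw [Nat.cast_zero, contDiff_zero, continuous_iff_continuousAt]
    exact fun x => (aux_hasFDerivAt_param u (hu.of_le (by exact_mod_cast le_top)) x).continuousAt
  | succ n ih =>
    intro F _ _ _ u hu
    have hu1 : ContDiff ℝ 1 u := hu.of_le (by exact_mod_cast le_top)
    rw [Nat.cast_succ, contDiff_succ_iff_hasFDerivAt]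
    refine ⟨_, ?_, fun x => aux_hasFDerivAt_param u hu1 x⟩
    exact ih (fun p : (ℝ × ℝ) × ℝ =>
      (fderiv ℝ u p).comp (ContinuousLinearMap.inl ℝ (ℝ × ℝ) ℝ))
      ((hu.fderiv_right (by simp)).clm_comp contDiff_const)

theorem aux_contDiff_param (u : (ℝ × ℝ) × ℝ → ℝ) (hu : ContDiff ℝ (⊤ : ℕ∞) u) :
    ContDiff ℝ (⊤ : ℕ∞) (fun x => ∫ t in (0:ℝ)..1, u (x, t)) :=
  contDiff_infty.2 fun n => aux_contDiff_param_nat n u hu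

noncomputable def auxD1 (u : ℝ × ℝ → ℝ) (p : ℝ × ℝ) : ℝ := fderiv ℝ u p (1, 0)
noncomputable def auxD2 (u : ℝ × ℝ → ℝ) (p : ℝ × ℝ) : ℝ := fderiv ℝ u p (0, 1)
noncomputable def auxH1 (u : ℝ × ℝ → ℝ) (p : ℝ × ℝ) : ℝ := ∫ t in (0:ℝ)..1, u (t * p.1, p.2)
noncomputable def auxH2 (u : ℝ × ℝ → ℝ) (p : ℝ × ℝ) : ℝ := ∫ t in (0:ℝ)..1, u (p.1, t * p.2)

variable {u : ℝ × ℝ → ℝ}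

theorem auxD1_smooth (hu : ContDiff ℝ (⊤ : ℕ∞) u) : ContDiff ℝ (⊤ : ℕ∞) (auxD1 u) :=
  (hu.fderiv_right (by simp)).clm_apply contDiff_const

theorem auxD2_smooth (hu : ContDiff ℝ (⊤ : ℕ∞) u) : ContDiff ℝ (⊤ : ℕ∞) (auxD2 u) :=
  (hu.fderiv_right (by simp)).clm_apply contDiff_const

theorem auxH1_smooth (hu : ContDiff ℝ (⊤ : ℕ∞) u) : ContDiff ℝ (⊤ : ℕ∞) (auxH1 u) :=
  aux_contDiff_param (fun q : (ℝ × ℝ) × ℝ => u (q.2 * q.1.1, q.1.2)) (hu.comp (by fun_prop))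

theorem auxH2_smooth (hu : ContDiff ℝ (⊤ : ℕ∞) u) : ContDiff ℝ (⊤ : ℕ∞) (auxH2 u) :=
  aux_contDiff_param (fun q : (ℝ × ℝ) × ℝ => u (q.1.1, q.2 * q.1.2)) (hu.comp (by fun_prop))

theorem auxD1_hasDerivAt (hu : ContDiff ℝ (⊤ : ℕ∞) u) (e x : ℝ) :
    HasDerivAt (fun s => u (s, x)) (auxD1 u (e, x)) e := by
  have h1 : HasFDerivAt u (fderiv ℝ u (e, x)) (e, x) :=
    (hu.differentiable (by simp) (e, x)).hasFDerivAt
  exact h1.comp_hasDerivAt e ((hasDerivAt_id e).prodMk (hasDerivAt_const e x))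

theorem auxD2_hasDerivAt (hu : ContDiff ℝ (⊤ : ℕ∞) u) (e x : ℝ) :
    HasDerivAt (fun s => u (e, s)) (auxD2 u (e, x)) x := by
  have h1 : HasFDerivAt u (fderiv ℝ u (e, x)) (e, x) :=
    (hu.differentiable (by simp) (e, x)).hasFDerivAt
  exact h1.comp_hasDerivAt x ((hasDerivAt_const x e).prodMk (hasDerivAt_id x))

/-- One-dimensional Hadamard lemma. -/
theorem aux_hadamard {v v' : ℝ → ℝ} (hv : ∀ x, HasDerivAt v (v' x) x) (hc : Continuous v')
    (h0 : v 0 = 0) (x : ℝ) : v x = x * ∫ t in (0:ℝ)..1, v' (t * x) := by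
  have h : ∫ t in (0:ℝ)..1, v' (t * x) * x = v (1 * x) - v (0 * x) := by
    refine intervalIntegral.integral_eq_sub_of_hasDerivAt (f := fun t => v (t * x)) (fun t _ => ?_) ?_
    · have h1 := (hv (t * x)).comp t ((hasDerivAt_id t).mul_const x)
      rw [one_mul] at h1
      exact h1
    · exact ((hc.comp (by fun_prop)).mul continuous_const).intervalIntegrable _ _
  rw [intervalIntegral.integral_mul_const, one_mul, zero_mul, h0, sub_zero] at h
  rw [← h, mul_comm]

theorem auxH2_eq (hu : ContDiff ℝ (⊤ : ℕ∞) u) (e : ℝ) (h0 : u (e, 0) = 0) (x : ℝ) :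
    u (e, x) = x * auxH2 (auxD2 u) (e, x) :=
  aux_hadamard (v := fun x => u (e, x)) (v' := fun x => auxD2 u (e, x))
    (fun x => auxD2_hasDerivAt hu e x) ((auxD2_smooth hu).continuous.comp (by fun_prop)) h0 x

theorem auxH1_eq (hu : ContDiff ℝ (⊤ : ℕ∞) u) (e x : ℝ) (h0 : u (0, x) = 0) :
    u (e, x) = e * auxH1 (auxD1 u) (e, x) :=
  aux_hadamard (v := fun e => u (e, x)) (v' := fun e => auxD1 u (e, x))
    (fun e => auxD1_hasDerivAt hu e x) ((auxD1_smooth hu).continuous.comp (by fun_prop)) h0 e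

theorem auxD2_odd (hu : ContDiff ℝ (⊤ : ℕ∞) u) (s : ℝ) (h : ∀ e x, u (e, -x) = s * u (e, x)) (e x : ℝ) :
    auxD2 u (e, -x) = -s * auxD2 u (e, x) := by
  have h1 := (auxD2_hasDerivAt hu e (-x)).comp x (hasDerivAt_neg x)
  have h2 := (auxD2_hasDerivAt hu e x).const_mul s
  have h3 : ((fun s => u (e, s)) ∘ fun x => -x) = fun x => s * u (e, x) := funext fun y => h e y
  rw [h3] at h1
  have := h1.unique h2
  linarith

theorem auxD1_odd (hu : ContDiff ℝ (⊤ : ℕ∞) u) (s : ℝ) (h : ∀ e x, u (e, -x) = s * u (e, x)) (e x : ℝ) :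
    auxD1 u (e, -x) = s * auxD1 u (e, x) := by
  have h1 := auxD1_hasDerivAt hu e (-x)
  have h2 := (auxD1_hasDerivAt hu e x).const_mul s
  have h3 : (fun s => u (s, -x)) = fun e => s * u (e, x) := funext fun y => h y x
  rw [h3] at h1
  exact h1.unique h2

theorem auxH1_odd (s : ℝ) (h : ∀ e x, u (e, -x) = s * u (e, x)) (e x : ℝ) :
    auxH1 u (e, -x) = s * auxH1 u (e, x) := by
  simp only [auxH1, h, intervalIntegral.integral_const_mul]

theorem auxH2_odd (s : ℝ) (h : ∀ e x, u (e, -x) = s * u (e, x)) (e x : ℝ) :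
    auxH2 u (e, -x) = s * auxH2 u (e, x) := by
  simp only [auxH2, mul_neg, h, intervalIntegral.integral_const_mul]

/-- Normal form of the family: `∂_z L (ε,z) = z (1 + ε G(ε,z))` and `∂_z G = z Q`. -/
theorem aux_normal (L : ℝ × ℝ → ℝ)
    (hL : ContDiff ℝ (⊤ : ℕ∞) L)
    (hL0 : ∀ z : ℝ, L (0, z) = z ^ 2 / 2)
    (heven : ∀ ε z : ℝ, L (ε, -z) = L (ε, z)) :
    ∃ G : ℝ × ℝ → ℝ, ContDiff ℝ (⊤ : ℕ∞) G ∧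
      (∀ e x, deriv (fun y => L (e, y)) x = x * (1 + e * G (e, x))) ∧
      (∀ e, auxD2 G (e, 0) = 0) := by
  have hM := auxD2_smooth hL
  have hLd : ∀ e x, deriv (fun y => L (e, y)) x = auxD2 L (e, x) :=
    fun e x => (auxD2_hasDerivAt hL e x).deriv
  set w : ℝ × ℝ → ℝ := fun p => auxD2 L p - p.2 with hw
  have hws : ContDiff ℝ (⊤ : ℕ∞) w := hM.sub contDiff_snd
  have hw0 : ∀ x, w (0, x) = 0 := by
    intro x
    have h1 := auxD2_hasDerivAt hL 0 x
    have h2 : HasDerivAt (fun z : ℝ => z ^ 2 / 2) x x := by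
      have := ((hasDerivAt_id x).pow 2).div_const 2
      simpa using this
    simp only [hL0] at h1
    simp [hw, h1.unique h2]
  have hodd : ∀ e x, w (e, -x) = (-1) * w (e, x) := by
    intro e x
    have := auxD2_odd hL 1 (by simpa using heven) e x
    simp only [hw, this]; ring
  set v := auxH1 (auxD1 w) with hv
  have hvs : ContDiff ℝ (⊤ : ℕ∞) v := auxH1_smooth (auxD1_smooth hws)
  have hvo : ∀ e x, v (e, -x) = (-1) * v (e, x) := auxH1_odd _ (auxD1_odd hws _ hodd)
  have hv0 : ∀ e, v (e, 0) = 0 := fun e => by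
    have := hvo e 0
    rw [neg_zero] at this; linarith
  have hGo : ∀ e x, auxH2 (auxD2 v) (e, -x) = 1 * auxH2 (auxD2 v) (e, x) :=
    auxH2_odd _ (fun e x => by rw [auxD2_odd hvs _ hvo]; ring)
  have hGs := auxH2_smooth (auxD2_smooth hvs)
  refine ⟨auxH2 (auxD2 v), hGs, fun e x => ?_, fun e => ?_⟩
  · have h1 := auxH1_eq hws e x (hw0 x)
    rw [← hv, auxH2_eq hvs e (hv0 e) x] at h1
    rw [hLd]
    simp only [hw] at h1
    linarith
  · have := auxD2_odd hGs 1 hGo e 0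
    rw [neg_zero] at this; linarith

end Aux

section Single
open Set Filter Topology

theorem aux_chain {h : ℝ → ℝ} {S : Set ℝ} {z d : ℝ} (hS : UniqueDiffWithinAt ℝ S z) (hz : z ∈ S)
    (hh : HasDerivWithinAt h d S z) {U F : ℝ → ℝ} {F' : ℝ} (hF : HasDerivAt F F' (h z))
    (hU : ∀ᶠ y in 𝓝[S] z, U y = F (h y)) :
    derivWithin U S z = F' * d := by
  have h1 : HasDerivWithinAt (fun y => F (h y)) (F' * d) S z := hF.comp_hasDerivWithinAt z hh
  have h2 : HasDerivWithinAt U (F' * d) S z :=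
    h1.congr_of_eventuallyEq hU (hU.self_of_nhdsWithin hz)
  exact h2.derivWithin hS

theorem aux_single (b e : ℝ) (hb : 0 < b) (he : 0 < e) (G G1 G2 G3 Q : ℝ → ℝ)
    (hG : ∀ x, HasDerivAt G (G1 x) x) (hG1 : ∀ x, HasDerivAt G1 (G2 x) x)
    (hG2 : ∀ x, HasDerivAt G2 (G3 x) x) (hQ : ∀ x, G1 x = x * Q x)
    (φ g P : ℝ → ℝ) (hφ : ∀ x, φ x = x * g x) (hg : ∀ x, g x = 1 + e * G x)
    (hP : ∀ x, P x = g x + e * (x * G1 x))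
    (hgpos : ∀ x ∈ Icc 0 b, 1 / 2 < g x) (hPpos : ∀ x ∈ Icc 0 b, 1 / 2 < P x)
    (hbeta : ∀ x ∈ Icc 0 b, g x * G2 x - 2 * e * G1 x ^ 2 < 0)
    (hgamma : ∀ x ∈ Icc 0 b, G2 x * P x - e * G1 x * (2 * G1 x + x * G2 x) < 0)
    (hdelta : ∀ x ∈ Icc 0 b, Q x < 0)
    (halpha : ∀ x ∈ Icc 0 b, ((3 * G2 x + x * G3 x) * P x - e * (2 * G1 x + x * G2 x) ^ 2) / P x ^ 3
      + 6 * Q x / g x ^ 2 - 4 * (Q x + G2 x) / (P x * g x) < 0) :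
    StrictMonoOn φ (Icc 0 b) ∧ ∀ h : ℝ → ℝ, (∀ z ∈ Icc (0 : ℝ) b, h (φ z) = z) →
        (∀ z ∈ Icc (0 : ℝ) (φ b), h z ∈ Icc (0 : ℝ) b ∧ φ (h z) = z) →
        let S := Icc (0 : ℝ) (φ b)
        let A : ℝ → ℝ := fun y => 1 / derivWithin h S y
        let B : ℝ → ℝ := fun y => y / h y
        ∀ z ∈ Ioc (0 : ℝ) (φ b),
          mtwBetaW S A B z < 0 ∧ mtwGammaW S B z < 0 ∧ mtwDeltaW S B z < 0 ∧
          mtwAlphaW S A B z + mtwDeltaW S B z <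
            2 * Real.sqrt (mtwBetaW S A B z * mtwGammaW S B z) := by
  have dg : ∀ x, HasDerivAt g (e * G1 x) x := fun x => by
    rw [funext hg]; exact ((hG x).const_mul e).const_add 1
  have dφ : ∀ x, HasDerivAt φ (P x) x := fun x => by
    rw [funext hφ]
    have := (hasDerivAt_id x).mul (dg x)
    refine this.congr_deriv ?_
    simp only [hP, id]; ring
  have dP : ∀ x, HasDerivAt P (e * (2 * G1 x + x * G2 x)) x := fun x => by
    rw [funext hP]
    have := (dg x).add (((hasDerivAt_id x).mul (hG1 x)).const_mul e)
    refine this.congr_deriv ?_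
    simp only [id]; ring
  have dP1 : ∀ x, HasDerivAt (fun x => e * (2 * G1 x + x * G2 x)) (e * (3 * G2 x + x * G3 x)) x :=
    fun x => by
    have := (((hG1 x).const_mul 2).add ((hasDerivAt_id x).mul (hG2 x))).const_mul e
    refine this.congr_deriv ?_
    simp only [id]; ring
  have hcφ : Continuous φ := continuous_iff_continuousAt.2 fun x => (dφ x).continuousAt
  have hlow : ∀ x ∈ Icc 0 b, ∀ y ∈ Icc 0 b, x ≤ y → (1 / 2) * (y - x) ≤ φ y - φ x := by
    refine (convex_Icc 0 b).mul_sub_le_image_sub_of_le_deriv hcφ.continuousOn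
      (fun x _ => (dφ x).differentiableAt.differentiableWithinAt) fun x hx => ?_
    rw [(dφ x).deriv]
    exact (hPpos x (interior_subset hx)).le
  refine ⟨fun x hx y hy hxy => by linarith [hlow x hx y hy hxy.le], ?_⟩
  intro h hl hr S A B z hz
  have hφb : 0 < φ b := hz.1.trans_le hz.2
  have hU : UniqueDiffOn ℝ S := uniqueDiffOn_Icc hφb
  have hLip : LipschitzOnWith 2 h S := by
    refine LipschitzOnWith.of_dist_le_mul fun y hy y' hy' => ?_
    obtain ⟨h1, h2⟩ := hr y hy
    obtain ⟨h3, h4⟩ := hr y' hy'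
    rw [Real.dist_eq, Real.dist_eq]
    rw [← h2, ← h4, h2, h4]
    have e2 : ((2 : NNReal) : ℝ) = 2 := rfl
    rw [e2]
    have k1 := neg_abs_le (y - y')
    have k2 := le_abs_self (y - y')
    rcases le_total (h y) (h y') with hle | hle
    · have := hlow _ h1 _ h3 hle
      rw [h2, h4] at this
      rw [abs_le]; constructor <;> linarith
    · have := hlow _ h3 _ h1 hle
      rw [h2, h4] at this
      rw [abs_le]; constructor <;> linarith
  have hPne : ∀ y ∈ S, P (h y) ≠ 0 := fun y hy => by
    have := hPpos _ (hr y hy).1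
    linarith
  have dh : ∀ y ∈ S, HasDerivWithinAt h (P (h y))⁻¹ S y := by
    intro y hy
    have h1 := ((dφ (h y)).hasFDerivAt_equiv (hPne y hy)).hasFDerivWithinAt (s := univ)
    refine (h1.of_local_left_inverse (g := h) (s := S) (a := y) ?_ hy ?_)
    · rw [nhdsWithin_univ]
      exact hLip.continuousOn y hy
    · exact eventually_nhdsWithin_of_forall fun y hy => (hr y hy).2
  have hA : ∀ y ∈ S, A y = P (h y) := fun y hy => by
    simp only [A]
    rw [(dh y hy).derivWithin (hU y hy), one_div, inv_inv]
  have hA1 : ∀ y ∈ S, derivWithin A S y = e * (2 * G1 (h y) + h y * G2 (h y)) * (P (h y))⁻¹ :=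
    fun y hy => aux_chain (hU y hy) hy (dh y hy) (dP (h y))
      (eventually_nhdsWithin_of_forall hA)
  have hzS : z ∈ S := ⟨hz.1.le, hz.2⟩
  have hA2 : derivWithin (fun y => derivWithin A S y) S z =
      ((e * (3 * G2 (h z) + h z * G3 (h z))) * P (h z) -
        (e * (2 * G1 (h z) + h z * G2 (h z))) * (e * (2 * G1 (h z) + h z * G2 (h z)))) / P (h z) ^ 2
        * (P (h z))⁻¹ :=
    aux_chain (hU z hzS) hzS (dh z hzS)
      ((dP1 (h z)).div (dP (h z)) (hPne z hzS))
      (eventually_nhdsWithin_of_forall fun y hy => by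
        rw [hA1 y hy, Pi.div_apply, div_eq_mul_inv])
  have hxpos : ∀ y ∈ S, 0 < y → 0 < h y := fun y hy hy0 => by
    obtain ⟨h1, h2⟩ := hr y hy
    refine h1.1.lt_of_ne fun h0 => ?_
    rw [← h0, hφ, zero_mul] at h2
    exact hy0.ne h2
  have hB : ∀ y ∈ S, 0 < y → B y = g (h y) := fun y hy hy0 => by
    have h2 := (hr y hy).2
    have h3 := (hxpos y hy hy0).ne'
    rw [hφ] at h2
    simp only [B]
    rw [div_eq_iff h3]
    linarith
  have hev : ∀ y, 0 < y → ∀ᶠ t in 𝓝[S] y, t ∈ S ∧ 0 < t := fun y hy =>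
    (eventually_mem_nhdsWithin).and (nhdsWithin_le_nhds (lt_mem_nhds hy))
  have hB1 : ∀ y ∈ S, 0 < y → derivWithin B S y = e * G1 (h y) * (P (h y))⁻¹ :=
    fun y hy hy0 => aux_chain (hU y hy) hy (dh y hy) (dg (h y))
      ((hev y hy0).mono fun t ht => hB t ht.1 ht.2)
  have hB2 : derivWithin (fun y => derivWithin B S y) S z =
      ((e * G2 (h z)) * P (h z) -
        (e * G1 (h z)) * (e * (2 * G1 (h z) + h z * G2 (h z)))) / P (h z) ^ 2
        * (P (h z))⁻¹ :=
    aux_chain (hU z hzS) hzS (dh z hzS)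
      (((hG1 (h z)).const_mul e).div (dP (h z)) (hPne z hzS))
      ((hev z hz.1).mono fun t ht => by
        rw [hB1 t ht.1 ht.2, Pi.div_apply, div_eq_mul_inv])
  have hxb := (hr z hzS).1
  have hx0 := hxpos z hzS hz.1
  have hzx := (hr z hzS).2
  have hAz := hA z hzS
  have hBz := hB z hzS hz.1
  have hA1z := hA1 z hzS
  have hB1z := hB1 z hzS hz.1
  rw [hφ] at hzx
  have a1 := hgpos _ hxb
  have a2 := hPpos _ hxb
  have a3 := hbeta _ hxb
  have a4 := hgamma _ hxb
  have a5 := hdelta _ hxb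
  have a6 := halpha _ hxb
  have a7 := hP (h z)
  have a8 := hQ (h z)
  generalize h z = x at *
  generalize P x = p at *
  generalize g x = c at *
  generalize G1 x = g1 at *
  generalize G2 x = g2 at *
  generalize G3 x = g3 at *
  generalize Q x = q at *
  have hc0 : 0 < c := by linarith
  have hp0 : 0 < p := by linarith
  have ebeta : mtwBetaW S A B z = e * (c * g2 - 2 * e * g1 ^ 2) / (p * c ^ 2) := by
    rw [mtwBetaW, hAz, hBz, hA1z, ← hzx]
    field_simp
    rw [a7]; ring
  have egamma : mtwGammaW S B z = e * (g2 * p - e * g1 * (2 * g1 + x * g2)) / p ^ 3 := by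
    rw [mtwGammaW, hB2]
    field_simp
  have edelta : mtwDeltaW S B z = e * q / (p * c) := by
    rw [mtwDeltaW, hB1z, ← hzx, a8]
    field_simp
  have ealpha : mtwAlphaW S A B z = e * (((3 * g2 + x * g3) * p - e * (2 * g1 + x * g2) ^ 2) / p ^ 3
      + 6 * q / c ^ 2 - 4 * (q + g2) / (p * c)) := by
    have hpc : p - c = e * (x * (x * q)) := by rw [a7, a8]; ring
    rw [mtwAlphaW, hA2, hAz, hBz, hA1z, hB1z, ← hzx, hpc, a8]
    field_simp
    ring
  have hβ : mtwBetaW S A B z < 0 := by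
    rw [ebeta]; exact div_neg_of_neg_of_pos (mul_neg_of_pos_of_neg he a3) (by positivity)
  have hγ : mtwGammaW S B z < 0 := by
    rw [egamma]; exact div_neg_of_neg_of_pos (mul_neg_of_pos_of_neg he a4) (by positivity)
  have hδ : mtwDeltaW S B z < 0 := by
    rw [edelta]; exact div_neg_of_neg_of_pos (mul_neg_of_pos_of_neg he a5) (by positivity)
  have hα : mtwAlphaW S A B z < 0 := by
    rw [ealpha]; exact mul_neg_of_pos_of_neg he a6
  refine ⟨hβ, hγ, hδ, ?_⟩
  have := Real.sqrt_nonneg (mtwBetaW S A B z * mtwGammaW S B z)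
  linarith

end Single

section Final
open Set Filter Topology

theorem aux_deriv_congr {f F F' : ℝ → ℝ} (hF : ∀ x, HasDerivAt F (F' x) x)
    (h : ∀ x, 0 < x → f x = F x) : ∀ x, 0 < x → deriv f x = F' x := fun x hx => by
  have : f =ᶠ[𝓝 x] F := (lt_mem_nhds hx).mono fun y hy => h y hy
  rw [this.deriv_eq, (hF x).deriv]

theorem aux_closure {b k : ℝ} (hb : 0 < b) {F : ℝ → ℝ} (hF : Continuous F)
    (h : ∀ x ∈ Ioc 0 b, F x < k) : ∀ x ∈ Icc 0 b, F x ≤ k := by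
  intro x hx
  rw [← closure_Ioc hb.ne] at hx
  exact closure_minimal (fun y hy => (h y hy).le) (isClosed_le hF continuous_const) hx

theorem aux_tube {b : ℝ} {F : ℝ × ℝ → ℝ} {a : ℝ} (h : ∀ x ∈ Icc 0 b, ContinuousAt F (0, x))
    (h0 : ∀ x ∈ Icc 0 b, F (0, x) < a) : ∀ᶠ e in 𝓝 (0:ℝ), ∀ x ∈ Icc 0 b, F (e, x) < a :=
  isCompact_Icc.eventually_forall_of_forall_eventually fun x hx =>
    (h x hx).eventually_lt continuousAt_const (h0 x hx)

end Final

/-- Perturbations of the Euclidean distance squared: let `L (ε, z) = l_ε(z)`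
be a smooth family of smooth even profiles with `l_0(z) = z²/2`, and let
`f(z) = ∂_ε l_ε'(z)|₀ / z`. If for some constant `k < 0` one has `f'' < k`
and `(z²f''' - zf'' + 2f')/z < k` on `(0,b]`, then for all sufficiently small
`ε > 0` the derivative `l_ε'` is strictly increasing on `[0,b]` and, `h_ε`
denoting its inverse on `[0, l_ε'(b)]`, the quantities `α, β, γ, δ` built
from `A = 1/h_ε'` and `B(z) = z/h_ε(z)` satisfy the strict
Ma-Trudinger-Wang inequalities on `(0, l_ε'(b)]`. -/
theorem stmt_19 (b : ℝ) (hb : 0 < b) (L : ℝ × ℝ → ℝ)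
    (hL : ContDiff ℝ (⊤ : ℕ∞) L)
    (hL0 : ∀ z : ℝ, L (0, z) = z ^ 2 / 2)
    (heven : ∀ ε z : ℝ, L (ε, -z) = L (ε, z))
    (f : ℝ → ℝ)
    (hf : ∀ z : ℝ, z ≠ 0 →
      f z = deriv (fun ε => deriv (fun y => L (ε, y)) z) 0 / z)
    (k : ℝ) (hk : k < 0)
    (hf'' : ∀ z ∈ Set.Ioc (0 : ℝ) b, deriv (deriv f) z < k)
    (hf''' : ∀ z ∈ Set.Ioc (0 : ℝ) b,
      (z ^ 2 * deriv (deriv (deriv f)) z - z * deriv (deriv f) z +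
        2 * deriv f z) / z < k) :
    ∃ ε₀ > (0 : ℝ), ∀ ε ∈ Set.Ioo (0 : ℝ) ε₀,
      StrictMonoOn (fun z => deriv (fun y => L (ε, y)) z) (Set.Icc 0 b) ∧
      ∀ h : ℝ → ℝ,
        (∀ z ∈ Set.Icc (0 : ℝ) b, h (deriv (fun y => L (ε, y)) z) = z) →
        (∀ z ∈ Set.Icc (0 : ℝ) (deriv (fun y => L (ε, y)) b),
          h z ∈ Set.Icc (0 : ℝ) b ∧ deriv (fun y => L (ε, y)) (h z) = z) →
        let S := Set.Icc (0 : ℝ) (deriv (fun y => L (ε, y)) b)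
        let A : ℝ → ℝ := fun y => 1 / derivWithin h S y
        let B : ℝ → ℝ := fun y => y / h y
        ∀ z ∈ Set.Ioc (0 : ℝ) (deriv (fun y => L (ε, y)) b),
          mtwBetaW S A B z < 0 ∧ mtwGammaW S B z < 0 ∧ mtwDeltaW S B z < 0 ∧
          mtwAlphaW S A B z + mtwDeltaW S B z <
            2 * Real.sqrt (mtwBetaW S A B z * mtwGammaW S B z) := by
  obtain ⟨G, hG, hLG, hG0⟩ := aux_normal L hL hL0 heven
  have hs1 := auxD2_smooth hG
  have hs2 := auxD2_smooth hs1
  have hs3 := auxD2_smooth hs2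
  have dG0 := auxD2_hasDerivAt hG
  have dG1 := auxD2_hasDerivAt hs1
  have dG2 := auxD2_hasDerivAt hs2
  have hQ : ∀ e x, auxD2 G (e, x) = x * auxH2 (auxD2 (auxD2 G)) (e, x) :=
    fun e x => auxH2_eq hs1 e (hG0 e) x
  have hsQ := auxH2_smooth hs2
  have cQ := hsQ.continuous
  have hQint : ∀ p : ℝ × ℝ, auxH2 (auxD2 (auxD2 G)) p =
    ∫ t in (0:ℝ)..1, auxD2 (auxD2 G) (p.1, t * p.2) := fun _ => rfl
  generalize auxH2 (auxD2 (auxD2 G)) = Q at *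
  generalize auxD2 (auxD2 (auxD2 G)) = G3 at *
  generalize auxD2 (auxD2 G) = G2 at *
  generalize auxD2 G = G1 at *
  have c0 := hG.continuous
  have c1 := hs1.continuous
  have c2 := hs2.continuous
  have c3 := hs3.continuous
  have hfG : ∀ z, 0 < z → f z = G (0, z) := by
    intro z hz
    rw [hf z hz.ne']
    simp only [hLG]
    have h1 : HasDerivAt (fun s => G (s, z)) (auxD1 G (0, z)) 0 := auxD1_hasDerivAt hG 0 z
    have h2 := ((((hasDerivAt_id (0:ℝ)).mul h1).const_add 1).const_mul z)
    have h3 : deriv (fun s => z * (1 + s * G (s, z))) 0 = z * G (0, z) := by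
      refine (h2.congr_deriv ?_).deriv
      simp
    rw [h3]
    field_simp
  have hf1 := aux_deriv_congr (dG0 0) hfG
  have hf2 := aux_deriv_congr (dG1 0) hf1
  have hf3 := aux_deriv_congr (dG2 0) hf2
  have k2 : ∀ x ∈ Set.Icc 0 b, G2 (0, x) ≤ k :=
    aux_closure (F := fun x => G2 (0, x)) hb (by fun_prop) fun x hx => by
      rw [← hf2 x hx.1]; exact hf'' x hx
  have k3 : ∀ x ∈ Set.Icc 0 b, x * G3 (0, x) - G2 (0, x) + 2 * Q (0, x) ≤ k :=
    aux_closure (F := fun x => x * G3 (0, x) - G2 (0, x) + 2 * Q (0, x)) hb (by fun_prop)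
      fun x hx => by
      have := hf''' x hx
      rw [hf2 x hx.1, hf1 x hx.1, hf3 x hx.1, hQ] at this
      refine lt_of_eq_of_lt ?_ this
      have := hx.1.ne'
      field_simp
  have kQ : ∀ x ∈ Set.Icc 0 b, Q (0, x) ≤ k := by
    intro x hx
    rw [hQint]
    have : ∫ t in (0:ℝ)..1, G2 (0, t * x) ≤ ∫ t in (0:ℝ)..1, k := by
      refine intervalIntegral.integral_mono_on zero_le_one
        (Continuous.intervalIntegrable (by fun_prop) _ _) intervalIntegrable_const fun t ht => ?_
      refine k2 _ ⟨mul_nonneg ht.1 hx.1, ?_⟩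
      nlinarith [ht.1, ht.2, hx.1, hx.2]
    simpa using this
  have E1 := aux_tube (b := b) (F := fun p => -(1 + p.1 * G p)) (a := -(1/2))
    (fun x _ => Continuous.continuousAt (by fun_prop)) (fun x _ => by norm_num)
  have E2 := aux_tube (b := b) (F := fun p => -((1 + p.1 * G p) + p.1 * (p.2 * G1 p))) (a := -(1/2))
    (fun x _ => Continuous.continuousAt (by fun_prop)) (fun x _ => by norm_num)
  have E3 := aux_tube (b := b) (F := fun p => (1 + p.1 * G p) * G2 p - 2 * p.1 * G1 p ^ 2) (a := 0)
    (fun x _ => Continuous.continuousAt (by fun_prop)) (fun x hx => by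
      simp only [zero_mul, mul_zero]; linarith [k2 x hx])
  have E4 := aux_tube (b := b) (F := fun p => G2 p * ((1 + p.1 * G p) + p.1 * (p.2 * G1 p)) -
      p.1 * G1 p * (2 * G1 p + p.2 * G2 p)) (a := 0)
    (fun x _ => Continuous.continuousAt (by fun_prop)) (fun x hx => by
      simp only [zero_mul]; linarith [k2 x hx])
  have E5 := aux_tube (b := b) (F := Q) (a := 0)
    (fun x _ => cQ.continuousAt) (fun x hx => by linarith [kQ x hx])
  have E6 := aux_tube (b := b) (F := fun p => ((3 * G2 p + p.2 * G3 p) *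
      ((1 + p.1 * G p) + p.1 * (p.2 * G1 p)) - p.1 * (2 * G1 p + p.2 * G2 p) ^ 2) /
        ((1 + p.1 * G p) + p.1 * (p.2 * G1 p)) ^ 3
      + 6 * Q p / (1 + p.1 * G p) ^ 2 - 4 * (Q p + G2 p) /
        (((1 + p.1 * G p) + p.1 * (p.2 * G1 p)) * (1 + p.1 * G p))) (a := 0)
    (fun x _ => by
      refine ContinuousAt.sub (ContinuousAt.add (ContinuousAt.div ?_ ?_ ?_)
        (ContinuousAt.div ?_ ?_ ?_)) (ContinuousAt.div ?_ ?_ ?_)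
      any_goals exact Continuous.continuousAt (by fun_prop)
      all_goals norm_num)
    (fun x hx => by
      have := k3 x hx
      simp only [zero_mul, add_zero, sub_zero, mul_one, one_pow, div_one]
      linarith)
  obtain ⟨ε₀, hε₀, H⟩ := Metric.eventually_nhds_iff.1
    (E1.and (E2.and (E3.and (E4.and (E5.and E6)))))
  refine ⟨ε₀, hε₀, fun ε hε => ?_⟩
  obtain ⟨F1, F2, F3, F4, F5, F6⟩ := @H ε (by
    rw [Real.dist_eq, sub_zero, abs_of_pos hε.1]; exact hε.2)
  exact aux_single b ε hb hε.1 (fun x => G (ε, x)) (fun x => G1 (ε, x)) (fun x => G2 (ε, x))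
    (fun x => G3 (ε, x)) (fun x => Q (ε, x)) (dG0 ε) (dG1 ε) (dG2 ε) (hQ ε)
    (fun z => deriv (fun y => L (ε, y)) z) (fun x => 1 + ε * G (ε, x))
    (fun x => (1 + ε * G (ε, x)) + ε * (x * G1 (ε, x)))
    (hLG ε) (fun _ => rfl) (fun _ => rfl)
    (fun x hx => by have := F1 x hx; simp only at this; linarith)
    (fun x hx => by have := F2 x hx; simp only at this; linarith)
    F3 F4 F5 F6
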